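/- arXiv:1806.06726 — 2 statements merged into one kernel-verified Lean document; each statement's English description precedes it below -/
import Mathlib

section
/- Let n ≥ 2, let r : Fin n → ℕ be a family of independent random variables, each geometrically distributed with P(r(i) = k) = 1/2^{k+1}, and for each realization of r let T(r) be the (unique) zip tree on nodes with keys 0, …, n−1 and ranks r. Then for every index i, the expected depth of node i in T(r) is at most (3/2)·lg n + 3. -/
open scoped ENNReal

/-- A binary tree whose nodes carry a key of type `α` and a natural-number rank. -/
inductive ZTree (α : Type) : Type where
  | leaf : ZTree α
  | node (left : ZTree α) (key : α) (rank : ℕ) (right : ZTree α) : ZTree α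

namespace ZTree
variable {α : Type} [LinearOrder α]

/-- The list of (key, rank) pairs of the nodes of the tree, in symmetric order. -/
def nodes : ZTree α → List (α × ℕ)
  | .leaf => []
  | .node l k rk r => l.nodes ++ (k, rk) :: r.nodes

/-- Binary-search-tree (symmetric order) property. -/
def isBST : ZTree α → Prop
  | .leaf => True
  | .node l k _ r =>
      (∀ p ∈ l.nodes, p.1 < k) ∧ (∀ p ∈ r.nodes, k < p.1) ∧ l.isBST ∧ r.isBST

/-- The rank of the root node, if any. -/
def rootRank? : ZTree α → Option ℕ
  | .leaf => none
  | .node _ _ rk _ => some rk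

/-- Max-heap order on ranks, ties broken in favor of smaller keys: every node's rank is
strictly greater than that of its left child and at least that of its right child. -/
def isRankHeap : ZTree α → Prop
  | .leaf => True
  | .node l _ rk r =>
      (∀ m ∈ l.rootRank?, m < rk) ∧ (∀ m ∈ r.rootRank?, m ≤ rk) ∧
        l.isRankHeap ∧ r.isRankHeap

/-- The zip-tree conditions: symmetric order on keys and heap order on ranks. -/
def isZipTree (t : ZTree α) : Prop := t.isBST ∧ t.isRankHeap

/-- The (key, rank) pairs on the search path from the root to the node with key `a`. -/
def pathTo (a : α) : ZTree α → List (α × ℕ)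
  | .leaf => []
  | .node l k rk r =>
      if a < k then (k, rk) :: l.pathTo a
      else if k < a then (k, rk) :: r.pathTo a
      else [(k, rk)]

/-- The depth (number of edges from the root) of the node with key `a`. -/
def depth (a : α) : ZTree α → ℕ
  | .leaf => 0
  | .node l k _ r =>
      if a < k then l.depth a + 1
      else if k < a then r.depth a + 1
      else 0

/-- The subtree rooted at the node with key `a`. -/
def subtreeAt (a : α) : ZTree α → ZTree α
  | .leaf => .leaf
  | .node l k rk r =>
      if a < k then l.subtreeAt a
      else if k < a then r.subtreeAt a
      else .node l k rk r

/-- Number of nodes on the left spine (root through left children). -/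
def leftSpineLen : ZTree α → ℕ
  | .leaf => 0
  | .node l _ _ _ => l.leftSpineLen + 1

/-- Number of nodes on the right spine (root through right children). -/
def rightSpineLen : ZTree α → ℕ
  | .leaf => 0
  | .node _ _ _ r => r.rightSpineLen + 1

/-- Total number of nodes on the right spine of the left subtree of the node with key `a`
together with the left spine of its right subtree: the paths zipped when deleting this
node, equivalently, the path unzipped when inserting it. -/
def zipSpineCount (a : α) (t : ZTree α) : ℕ :=
  match t.subtreeAt a with
  | .leaf => 0
  | .node l _ _ r => l.rightSpineLen + r.leftSpineLen

end ZTree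


namespace ZTree

/-- In a heap-ordered tree, a bound on the rank of the root bounds every rank. -/
theorem rank_le_of_mem_nodes {α : Type} {t : ZTree α} (ht : t.isRankHeap) {b : ℕ}
    (hb : ∀ m ∈ t.rootRank?, m ≤ b) : ∀ p ∈ t.nodes, p.2 ≤ b := by
  induction t generalizing b with
  | leaf => simp [nodes]
  | node l k rk r ihl ihr =>
    obtain ⟨h1, h2, hl, hr⟩ := ht
    have hrk : rk ≤ b := hb rk (by simp [rootRank?])
    intro p hp
    simp only [nodes, List.mem_append, List.mem_cons] at hp
    rcases hp with hp | rfl | hp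
    · exact ihl hl (fun m hm => (h1 m hm).le.trans hrk) p hp
    · exact hrk
    · exact ihr hr (fun m hm => (h2 m hm).trans hrk) p hp

theorem rank_lt_of_mem_nodes {α : Type} {t : ZTree α} (ht : t.isRankHeap) {b : ℕ}
    (hb : ∀ m ∈ t.rootRank?, m < b) : ∀ p ∈ t.nodes, p.2 < b := by
  intro p hp
  cases b with
  | zero =>
    cases t with
    | leaf => simp [nodes] at hp
    | node l k rk r => exact absurd (hb rk (by simp [rootRank?])) (by omega)
  | succ b =>
    exact Nat.lt_succ_of_le
      (rank_le_of_mem_nodes ht (fun m hm => Nat.le_of_lt_succ (hb m hm)) p hp)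

variable {α : Type} [LinearOrder α]

/-- `p` dominates every node between it and the key `a`: the condition for `p` to be a proper
ancestor of the node with key `a`. -/
def Dominates (t : ZTree α) (a : α) (p : α × ℕ) : Prop :=
  (p.1 < a ∧ ∀ q ∈ t.nodes, p.1 < q.1 → q.1 ≤ a → q.2 ≤ p.2) ∨
    (a < p.1 ∧ ∀ q ∈ t.nodes, a ≤ q.1 → q.1 < p.1 → q.2 < p.2)

open Classical in
theorem depth_le_card_dominates (a : α) {t : ZTree α} (ht : t.isZipTree) :
    t.depth a ≤ (t.nodes.toFinset.filter (t.Dominates a)).card := by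
  induction t with
  | leaf => simp [depth]
  | node l k rk r ihl ihr =>
    obtain ⟨⟨hlk, hkr, hbl, hbr⟩, h1, h2, hhl, hhr⟩ := ht
    have hrl := rank_lt_of_mem_nodes hhl h1
    have hrr := rank_le_of_mem_nodes hhr h2
    have step : ∀ s : ZTree α, (k, rk) ∉ s.nodes →
        s.depth a ≤ (s.nodes.toFinset.filter (s.Dominates a)).card →
        (∀ p ∈ s.nodes, p ∈ (node l k rk r).nodes) →
        (∀ p ∈ s.nodes, s.Dominates a p → (node l k rk r).Dominates a p) →
        (node l k rk r).Dominates a (k, rk) →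
        s.depth a + 1 ≤
          ((node l k rk r).nodes.toFinset.filter ((node l k rk r).Dominates a)).card := by
      intro s hs hd hsub hdom hk
      refine (Nat.succ_le_succ hd).trans ?_
      rw [Nat.succ_eq_add_one,
        ← Finset.card_insert_of_notMem (a := (k, rk)) (by simp [hs])]
      refine Finset.card_le_card fun p hp => ?_
      simp only [Finset.mem_insert, Finset.mem_filter, List.mem_toFinset] at hp ⊢
      rcases hp with rfl | ⟨hp, hp'⟩
      · exact ⟨by simp [nodes], hk⟩
      · exact ⟨hsub p hp, hdom p hp hp'⟩
    have mem : ∀ q, q ∈ (node l k rk r).nodes ↔ q ∈ l.nodes ∨ q = (k, rk) ∨ q ∈ r.nodes := by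
      simp [nodes]
    simp only [depth]
    split_ifs with hak hka
    · refine step l (fun h => lt_irrefl _ (hlk _ h)) (ihl ⟨hbl, hhl⟩)
        (fun p hp => (mem p).2 (.inl hp)) ?_ (.inr ⟨hak, ?_⟩)
      · have below : ∀ q ∈ (node l k rk r).nodes, q.1 < k → q ∈ l.nodes := by
          intro q hq hqk
          rcases (mem q).1 hq with h | rfl | h
          · exact h
          · exact absurd hqk (lt_irrefl _)
          · exact absurd hqk (hkr q h).not_gt
        rintro p hp (⟨hpa, h⟩ | ⟨hpa, h⟩)
        · exact .inl ⟨hpa, fun q hq h3 h4 => h q (below q hq (h4.trans_lt hak)) h3 h4⟩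
        · exact .inr ⟨hpa, fun q hq h3 h4 => h q (below q hq (h4.trans (hlk p hp))) h3 h4⟩
      · intro q hq _ hqk
        rcases (mem q).1 hq with h | rfl | h
        · exact hrl q h
        · exact absurd hqk (lt_irrefl _)
        · exact absurd hqk (hkr q h).not_gt
    · refine step r (fun h => lt_irrefl _ (hkr _ h)) (ihr ⟨hbr, hhr⟩)
        (fun p hp => (mem p).2 (.inr (.inr hp))) ?_ (.inl ⟨hka, ?_⟩)
      · have above : ∀ q ∈ (node l k rk r).nodes, k < q.1 → q ∈ r.nodes := by
          intro q hq hqk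
          rcases (mem q).1 hq with h | rfl | h
          · exact absurd hqk (hlk q h).not_gt
          · exact absurd hqk (lt_irrefl _)
          · exact h
        rintro p hp (⟨hpa, h⟩ | ⟨hpa, h⟩)
        · exact .inl ⟨hpa, fun q hq h3 h4 => h q (above q hq ((hkr p hp).trans h3)) h3 h4⟩
        · exact .inr ⟨hpa, fun q hq h3 h4 => h q (above q hq (hka.trans_le h3)) h3 h4⟩
      · intro q hq hqk _
        rcases (mem q).1 hq with h | rfl | h
        · exact absurd hqk (hlk q h).not_gt
        · exact absurd hqk (lt_irrefl _)
        · exact hrr q h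
    · exact Nat.zero_le _

end ZTree

open Finset

/-- A sum over families of a product of one-coordinate factors is a product of sums. -/
theorem ENNReal.tsum_pi_prod {β : Type*} {n : ℕ} (h : Fin n → β → ℝ≥0∞) :
    ∑' f : Fin n → β, ∏ j, h j (f j) = ∏ j, ∑' x, h j x := by
  induction n with
  | zero => simp
  | succ n ih =>
    rw [← (Fin.consEquiv fun _ : Fin (n + 1) => β).tsum_eq, ENNReal.tsum_prod',
      Fin.prod_univ_succ, ← ih, ← ENNReal.tsum_mul_right]
    simp [Fin.consEquiv, Fin.prod_univ_succ, ENNReal.tsum_mul_left]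

/-- For independent coordinates with law `p`, the probability that all coordinates in `s` land
in a set depending on coordinate `j ∉ s`. -/
theorem ENNReal.tsum_prod_mul_indicator {β : Type*} {n : ℕ} {p : β → ℝ≥0∞}
    (hp : ∑' x, p x = 1) {j : Fin n} {s : Finset (Fin n)} (hj : j ∉ s) (R : β → β → Prop) [DecidableRel R] :
    ∑' f : Fin n → β, (∏ l, p (f l)) * (if ∀ l ∈ s, R (f l) (f j) then 1 else 0) =
      ∑' k, p k * (∑' x, if R x k then p x else 0) ^ #s := by
  classical
  have key : ∀ f : Fin n → β,
      (∏ l, p (f l)) * (if ∀ l ∈ s, R (f l) (f j) then 1 else 0) =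
        ∑' k, ∏ l, (if l = j then (if f l = k then p (f l) else 0) else
          if l ∈ s then (if R (f l) k then p (f l) else 0) else p (f l)) := by
    intro f
    rw [tsum_eq_single (f j)]
    · split_ifs with hR
      · rw [mul_one]
        refine prod_congr rfl fun l _ => ?_
        by_cases h : l = j
        · simp [h]
        · by_cases h' : l ∈ s <;> simp [h, h', hR]
      · push Not at hR
        obtain ⟨l, hl, hR⟩ := hR
        rw [mul_zero, eq_comm]
        refine prod_eq_zero (mem_univ l) ?_
        have : l ≠ j := fun h => hj (h ▸ hl)
        simp [this, hl, hR]
    · intro k hk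
      exact prod_eq_zero (mem_univ j) (by simp [hk.symm])
  simp_rw [key]
  rw [ENNReal.tsum_comm]
  refine tsum_congr fun k => ?_
  rw [ENNReal.tsum_pi_prod (fun l x => if l = j then (if x = k then p x else 0) else
          if l ∈ s then (if R x k then p x else 0) else p x)]
  rw [← mul_prod_erase univ _ (mem_univ j)]
  congr 1
  · simp
  · refine (prod_subset (s₁ := s) (s₂ := univ.erase j) ?_ ?_).symm.trans ?_
    · intro l hl
      exact mem_erase.2 ⟨fun h => hj (h ▸ hl), mem_univ _⟩
    · intro l hl hl'
      simp [(mem_erase.1 hl).1, hl', hp]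
    · rw [← prod_const]
      refine prod_congr rfl fun l hl => ?_
      have : l ≠ j := fun h => hj (h ▸ hl)
      simp [this, hl]

theorem ENNReal.mul_geom_sum_add_pow {p q : ℝ≥0∞} (h : p + q = 1) (N : ℕ) :
    p * ∑ m ∈ range N, q ^ m + q ^ N = 1 := by
  induction N with
  | zero => simp
  | succ N ih =>
    rw [sum_range_succ, mul_add, pow_succ', add_assoc, ← add_mul, h, one_mul, ih]

/-- The geometric weights with mean one sum to one. -/
theorem tsum_half_pow_succ : ∑' k : ℕ, (1 / 2 : ℝ≥0∞) ^ (k + 1) = 1 := by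
  rw [ENNReal.tsum_geometric_add_one]
  simp only [one_div, ENNReal.one_sub_inv_two, inv_inv]
  exact ENNReal.inv_mul_cancel (by simp) (by simp)

theorem half_pow_add_tsum_le (k : ℕ) :
    (1 / 2 : ℝ≥0∞) ^ (k + 1) + ∑' x : ℕ, (if x ≤ k then (1 / 2 : ℝ≥0∞) ^ (x + 1) else 0) = 1 := by
  rw [tsum_eq_sum (s := range (k + 1)) (fun x hx => by simp at hx; simp; omega)]
  have : ∀ m, (1 / 2 : ℝ≥0∞) ^ m + ∑ x ∈ range m, (1 / 2 : ℝ≥0∞) ^ (x + 1) = 1 := by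
    intro m
    induction m with
    | zero => simp
    | succ m ih =>
      rw [sum_range_succ, add_comm (∑ x ∈ _, _), ← add_assoc, ← two_mul, pow_succ', ← mul_assoc,
        show (2 : ℝ≥0∞) * (1 / 2) = 1 from ENNReal.mul_div_cancel (by simp) (by simp), one_mul, ih]
  refine Eq.trans ?_ (this (k + 1))
  refine congrArg ((1 / 2 : ℝ≥0∞) ^ (k + 1) + ·) (Finset.sum_congr rfl fun x hx => ?_)
  rw [if_pos (Nat.le_of_lt_succ (mem_range.1 hx))]

/-- The probability that a geometric random variable with mean one is at most `k`. -/
noncomputable def geometricCDF (k : ℕ) : ℝ≥0∞ :=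
  ∑' x : ℕ, if x ≤ k then (1 / 2 : ℝ≥0∞) ^ (x + 1) else 0

/-- The expected number of indices `m < n` such that a geometric random variable is at least as
large as `m` other ones, all of them independent. -/
noncomputable def expectedDominations (n : ℕ) : ℝ≥0∞ :=
  ∑' k : ℕ, (1 / 2 : ℝ≥0∞) ^ (k + 1) * ∑ m ∈ range n, geometricCDF k ^ m

theorem geometricCDF_le_one (k : ℕ) : geometricCDF k ≤ 1 := by
  rw [← half_pow_add_tsum_le k]
  exact le_add_left le_rfl

theorem expectedDominations_le {n L : ℕ} (hn : n ≤ 2 ^ (L + 1)) :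
    expectedDominations n ≤ L + 2 := by
  rw [expectedDominations, ← ENNReal.summable.sum_add_tsum_nat_add' (k := L)]
  refine add_le_add ?_ ?_
  · calc _ ≤ ∑ _k ∈ range L, (1 : ℝ≥0∞) := sum_le_sum fun k _ => by
          exact le_self_add.trans_eq (ENNReal.mul_geom_sum_add_pow (half_pow_add_tsum_le k) n)
      _ = L := by simp
  · have bound : ∀ k, ∑ m ∈ range n, geometricCDF k ^ m ≤ 2 ^ (L + 1) := fun k =>
      calc _ ≤ ∑ _m ∈ range n, (1 : ℝ≥0∞) :=
            sum_le_sum fun m _ => pow_le_one₀ zero_le (geometricCDF_le_one k)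
        _ = n := by simp
        _ ≤ 2 ^ (L + 1) := mod_cast hn
    calc _ ≤ ∑' k : ℕ, (1 / 2 : ℝ≥0∞) ^ (k + L + 1) * 2 ^ (L + 1) :=
          ENNReal.tsum_le_tsum fun k => mul_le_mul_right (bound _) _
      _ = ∑' k : ℕ, (1 / 2 : ℝ≥0∞) ^ (k + 1) * 2 := tsum_congr fun k => by
          have : (1 / 2 : ℝ≥0∞) ^ L * 2 ^ L = 1 := by
            rw [← mul_pow, ENNReal.div_mul_cancel (by simp) (by simp), one_pow]
          calc _ = (1 / 2 : ℝ≥0∞) ^ (k + 1) * 2 * ((1 / 2 : ℝ≥0∞) ^ L * 2 ^ L) := by ring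
            _ = _ := by rw [this, mul_one]
      _ = 2 := by rw [ENNReal.tsum_mul_right, tsum_half_pow_succ, one_mul]

theorem expectedDominations_le_logb (n : ℕ) :
    expectedDominations n ≤ ENNReal.ofReal (Real.logb 2 n + 2) := by
  have hlog : (Nat.log 2 n : ℝ) ≤ Real.logb 2 n := by
    simpa using Real.natLog_le_logb n 2
  refine (expectedDominations_le (L := Nat.log 2 n)
    (Nat.lt_pow_succ_log_self one_lt_two n).le).trans ?_
  calc (Nat.log 2 n : ℝ≥0∞) + 2 = ENNReal.ofReal (Nat.log 2 n + 2) := by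
        rw [ENNReal.ofReal_add (by positivity) (by norm_num)]
        simp
    _ ≤ _ := ENNReal.ofReal_le_ofReal (by linarith)

/-- The expected number of indices `j < i` whose rank is at least the ranks of all indices in
`(j, i]`. -/
theorem sum_prob_left_le {n : ℕ} (i : Fin n) :
    ∑ j ∈ Iio i, ∑' f : Fin n → ℕ, (∏ l, (1 / 2 : ℝ≥0∞) ^ (f l + 1)) *
      (if ∀ l ∈ Ioc j i, f l ≤ f j then 1 else 0) ≤ expectedDominations n := by
  have h : ∀ j ∈ Iio i, ∑' f : Fin n → ℕ, (∏ l, (1 / 2 : ℝ≥0∞) ^ (f l + 1)) *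
      (if ∀ l ∈ Ioc j i, f l ≤ f j then 1 else 0) =
        ∑' k : ℕ, (1 / 2 : ℝ≥0∞) ^ (k + 1) * geometricCDF k ^ ((i : ℕ) - j) := by
    intro j _
    rw [ENNReal.tsum_prod_mul_indicator (p := fun k : ℕ => (1 / 2 : ℝ≥0∞) ^ (k + 1))
      tsum_half_pow_succ (by simp) (fun x k => x ≤ k), Fin.card_Ioc]
    rfl
  have inj : Set.InjOn (fun j : Fin n => (i : ℕ) - j) (Iio i : Finset (Fin n)) := by
    intro j hj j' hj' hjj
    simp only [coe_Iio, Set.mem_Iio, Fin.lt_def] at hj hj' hjj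
    ext
    omega
  rw [sum_congr rfl h, ← Summable.tsum_finsetSum fun _ _ => ENNReal.summable]
  refine ENNReal.tsum_le_tsum fun k => ?_
  rw [← mul_sum, ← sum_image (f := fun m => geometricCDF k ^ m) inj]
  gcongr
  intro m hm
  obtain ⟨j, _, rfl⟩ := mem_image.1 hm
  exact mem_range.2 (by omega)

/-- The expected number of indices `j > i` whose rank exceeds the ranks of all indices in
`[i, j)`. -/
theorem sum_prob_right_le {n : ℕ} (i : Fin n) :
    ∑ j ∈ Ioi i, ∑' f : Fin n → ℕ, (∏ l, (1 / 2 : ℝ≥0∞) ^ (f l + 1)) *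
      (if ∀ l ∈ Ico i j, f l < f j then 1 else 0) ≤ 1 / 2 * expectedDominations n := by
  have h : ∀ j ∈ Ioi i, ∑' f : Fin n → ℕ, (∏ l, (1 / 2 : ℝ≥0∞) ^ (f l + 1)) *
      (if ∀ l ∈ Ico i j, f l < f j then 1 else 0) =
        ∑' k : ℕ, 1 / 2 * ((1 / 2 : ℝ≥0∞) ^ (k + 1) * geometricCDF k ^ ((j : ℕ) - i)) := by
    intro j hj
    have hij : (j : ℕ) - i ≠ 0 := by
      have := Fin.lt_def.1 (mem_Ioi.1 hj)
      omega
    rw [ENNReal.tsum_prod_mul_indicator (p := fun k : ℕ => (1 / 2 : ℝ≥0∞) ^ (k + 1))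
      tsum_half_pow_succ (by simp) (fun x k => x < k), Fin.card_Ico,
      tsum_eq_zero_add' ENNReal.summable]
    simp only [not_lt_zero, if_false, tsum_zero, zero_pow hij, mul_zero, zero_add,
      Nat.lt_succ_iff]
    refine tsum_congr fun k => ?_
    rw [pow_succ' _ (k + 1), mul_assoc]
    rfl
  have inj : Set.InjOn (fun j : Fin n => (j : ℕ) - i) (Ioi i : Finset (Fin n)) := by
    intro j hj j' hj' hjj
    simp only [coe_Ioi, Set.mem_Ioi, Fin.lt_def] at hj hj' hjj
    ext
    omega
  rw [sum_congr rfl h, ← Summable.tsum_finsetSum fun _ _ => ENNReal.summable,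
    expectedDominations, ← ENNReal.tsum_mul_left]
  refine ENNReal.tsum_le_tsum fun k => ?_
  rw [← mul_sum, ← mul_sum, ← sum_image (f := fun m => geometricCDF k ^ m) inj]
  gcongr
  intro m hm
  obtain ⟨j, _, rfl⟩ := mem_image.1 hm
  exact mem_range.2 (by omega)

/-- The depth of a node is at most the number of its dominating nodes on either side. -/
theorem ZTree.depth_le_sum {n : ℕ} {t : ZTree ℕ} {f : Fin n → ℕ} (ht : t.isZipTree)
    (hn : t.nodes.Perm ((List.finRange n).map fun j : Fin n => ((j : ℕ), f j))) (i : Fin n) :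
    (t.depth (i : ℕ) : ℝ≥0∞) ≤
      ∑ j ∈ Iio i, (if ∀ l ∈ Ioc j i, f l ≤ f j then 1 else 0) +
        ∑ j ∈ Ioi i, (if ∀ l ∈ Ico i j, f l < f j then 1 else 0) := by
  have mem : ∀ p, p ∈ t.nodes ↔ ∃ j : Fin n, ((j : ℕ), f j) = p := by
    intro p
    simp [hn.mem_iff]
  classical
  have hsub : t.nodes.toFinset.filter (t.Dominates (i : ℕ)) ⊆
      ((Iio i).filter (fun j => ∀ l ∈ Ioc j i, f l ≤ f j) ∪
        (Ioi i).filter (fun j => ∀ l ∈ Ico i j, f l < f j)).image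
          fun j : Fin n => ((j : ℕ), f j) := by
    intro p hp
    simp only [mem_filter, List.mem_toFinset] at hp
    obtain ⟨hp, hdom⟩ := hp
    obtain ⟨j, rfl⟩ := (mem p).1 hp
    refine mem_image_of_mem _ (mem_union.2 (hdom.imp ?_ ?_))
    · rintro ⟨hji, h⟩
      refine mem_filter.2 ⟨mem_Iio.2 hji, fun l hl => ?_⟩
      exact h _ ((mem _).2 ⟨l, rfl⟩) (mem_Ioc.1 hl).1 (mem_Ioc.1 hl).2
    · rintro ⟨hij, h⟩
      refine mem_filter.2 ⟨mem_Ioi.2 hij, fun l hl => ?_⟩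
      exact h _ ((mem _).2 ⟨l, rfl⟩) (mem_Ico.1 hl).1 (mem_Ico.1 hl).2
  have hcard := (ZTree.depth_le_card_dominates (i : ℕ) ht).trans
    ((card_le_card hsub).trans (card_image_le.trans (card_union_le _ _)))
  rw [sum_boole, sum_boole]
  exact_mod_cast hcard

/-- **Expected node depth (Theorem 2, expectation part).** Let `n ≥ 2`, let
`r : Fin n → ℕ` be independent geometric random variables with
`P(r i = k) = 1/2^(k+1)` (modelled by the product PMF `μ`), and for each realization
`r` let `T r` be the (unique) zip tree on nodes with keys `0, …, n−1` and ranks `r`.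
Then for every index `i`, the expected depth of node `i` in `T r` is at most
`(3/2)·lg n + 3`. -/
theorem expected_depth (n : ℕ) (hn : 2 ≤ n)
    (μ : PMF (Fin n → ℕ))
    (hμ : ∀ f : Fin n → ℕ, μ f = ∏ j : Fin n, (1 / 2 : ℝ≥0∞) ^ (f j + 1))
    (T : (Fin n → ℕ) → ZTree ℕ)
    (hT : ∀ f : Fin n → ℕ, (T f).isZipTree ∧
        (T f).nodes.Perm ((List.finRange n).map fun j : Fin n => ((j : ℕ), f j)))
    (i : Fin n) :
    ∑' f : Fin n → ℕ, μ f * (((T f).depth (i : ℕ) : ℕ) : ℝ≥0∞) ≤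
      ENNReal.ofReal ((3 / 2) * Real.logb 2 n + 3) := by
  calc ∑' f : Fin n → ℕ, μ f * (((T f).depth (i : ℕ) : ℕ) : ℝ≥0∞)
      ≤ ∑' f : Fin n → ℕ,
          (∑ j ∈ Iio i, (∏ l, (1 / 2 : ℝ≥0∞) ^ (f l + 1)) *
              (if ∀ l ∈ Ioc j i, f l ≤ f j then 1 else 0) +
            ∑ j ∈ Ioi i, (∏ l, (1 / 2 : ℝ≥0∞) ^ (f l + 1)) *
              (if ∀ l ∈ Ico i j, f l < f j then 1 else 0)) := by
        refine ENNReal.tsum_le_tsum fun f => ?_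
        rw [← mul_sum, ← mul_sum, ← mul_add, hμ f]
        gcongr
        exact ZTree.depth_le_sum (hT f).1 (hT f).2 i
    _ ≤ expectedDominations n + 1 / 2 * expectedDominations n := by
        rw [ENNReal.tsum_add, Summable.tsum_finsetSum fun _ _ => ENNReal.summable,
          Summable.tsum_finsetSum fun _ _ => ENNReal.summable]
        exact add_le_add (sum_prob_left_le i) (sum_prob_right_le i)
    _ = ENNReal.ofReal (3 / 2) * expectedDominations n := by
        rw [show (3 / 2 : ℝ) = 1 + 1 / 2 by norm_num,
          ENNReal.ofReal_add zero_le_one (by norm_num), add_mul,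
          ENNReal.ofReal_div_of_pos two_pos]
        simp
    _ ≤ ENNReal.ofReal (3 / 2) * ENNReal.ofReal (Real.logb 2 n + 2) := by
        gcongr
        exact expectedDominations_le_logb n
    _ = ENNReal.ofReal ((3 / 2) * Real.logb 2 n + 3) := by
        rw [← ENNReal.ofReal_mul (by norm_num)]
        congr 1
        ring
end

section
/- Let r : Fin n → ℕ be a family of independent geometric random variables with P(r(j) = m) = 1/2^{m+1}, let i be any index, and let T(r) be the (unique) zip tree on nodes with keys 0, …, n−1 and ranks r. Then the expected total number of nodes on the right spine of the left subtree of node i together with the left spine of the right subtree of node i is at most 2; in particular, the expected number of pointer changes during the unzip performed when inserting node i, or the zip performed when deleting node i, is O(1). -/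
open scoped ENNReal

namespace ZTree
variable {α : Type}

/-- The (key, rank) pairs on the right spine, from the root downwards. -/
def rightSpine : ZTree α → List (α × ℕ)
  | .leaf => []
  | .node _ k rk r => (k, rk) :: r.rightSpine

/-- The (key, rank) pairs on the left spine, from the bottom upwards. -/
def leftSpine : ZTree α → List (α × ℕ)
  | .leaf => []
  | .node l k rk _ => l.leftSpine ++ [(k, rk)]

theorem length_rightSpine (t : ZTree α) : t.rightSpine.length = t.rightSpineLen := by
  induction t with
  | leaf => rfl
  | node l k rk r _ ihr => simp [rightSpine, rightSpineLen, ihr]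

theorem length_leftSpine (t : ZTree α) : t.leftSpine.length = t.leftSpineLen := by
  induction t with
  | leaf => rfl
  | node l k rk r ihl _ => simp [leftSpine, leftSpineLen, ihl]

theorem rightSpine_sublist (t : ZTree α) : t.rightSpine.Sublist t.nodes := by
  induction t with
  | leaf => exact List.Sublist.refl _
  | node l k rk r _ ihr => exact (ihr.cons_cons _).trans (List.sublist_append_right _ _)

theorem leftSpine_sublist (t : ZTree α) : t.leftSpine.Sublist t.nodes := by
  induction t with
  | leaf => exact List.Sublist.refl _
  | node l k rk r ihl _ => exact ihl.append ((List.nil_sublist _).cons_cons _)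

theorem isRankHeap.rank_le {t : ZTree α} (ht : t.isRankHeap) {m : ℕ}
    (hm : ∀ x ∈ t.rootRank?, x ≤ m) : ∀ q ∈ t.nodes, q.2 ≤ m := by
  induction t generalizing m with
  | leaf => simp [nodes]
  | node l k rk r ihl ihr =>
    obtain ⟨hl, hr, hl', hr'⟩ := ht
    have hk : rk ≤ m := hm rk rfl
    intro q hq
    simp only [nodes, List.mem_append, List.mem_cons] at hq
    rcases hq with hq | rfl | hq
    · exact ihl hl' (fun x hx => (hl x hx).le.trans hk) q hq
    · exact hk
    · exact ihr hr' (fun x hx => (hr x hx).trans hk) q hq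

theorem isRankHeap.rank_lt {t : ZTree α} (ht : t.isRankHeap) {m : ℕ}
    (hm : ∀ x ∈ t.rootRank?, x < m) : ∀ q ∈ t.nodes, q.2 < m := by
  intro q hq
  cases m with
  | zero =>
    cases t with
    | leaf => simp [nodes] at hq
    | node l k rk r => exact absurd (hm rk rfl) (Nat.not_lt_zero _)
  | succ m => exact Nat.lt_succ_of_le (ht.rank_le (fun x hx => Nat.le_of_lt_succ (hm x hx)) q hq)

variable [LinearOrder α]

theorem isZipTree.rank_le_of_mem_rightSpine {t : ZTree α} (ht : t.isZipTree) :
    ∀ p ∈ t.rightSpine, ∀ q ∈ t.nodes, p.1 < q.1 → q.2 ≤ p.2 := by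
  induction t with
  | leaf => simp [rightSpine]
  | node l k rk r ihl ihr =>
    intro p hp q hq hpq
    obtain ⟨⟨bl, br, bl', br'⟩, hh⟩ := ht
    rcases List.mem_cons.1 hp with rfl | hp
    · exact hh.rank_le (by simp [rootRank?]) q hq
    · have hkp := br p (r.rightSpine_sublist.subset hp)
      simp only [nodes, List.mem_append, List.mem_cons] at hq
      rcases hq with hq | rfl | hq
      · exact absurd (hpq.trans (bl q hq)) hkp.asymm
      · exact absurd hpq hkp.asymm
      · exact ihr ⟨br', hh.2.2.2⟩ p hp q hq hpq

theorem isZipTree.rank_lt_of_mem_leftSpine {t : ZTree α} (ht : t.isZipTree) :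
    ∀ p ∈ t.leftSpine, ∀ q ∈ t.nodes, q.1 < p.1 → q.2 < p.2 := by
  induction t with
  | leaf => simp [leftSpine]
  | node l k rk r ihl ihr =>
    intro p hp q hq hpq
    obtain ⟨⟨bl, br, bl', br'⟩, hh⟩ := ht
    simp only [nodes, List.mem_append, List.mem_cons] at hq
    simp only [leftSpine, List.mem_append, List.mem_singleton] at hp
    rcases hp with hp | rfl
    · have hkp := bl p (l.leftSpine_sublist.subset hp)
      rcases hq with hq | rfl | hq
      · exact ihl ⟨bl', hh.2.2.1⟩ p hp q hq hpq
      · exact absurd hpq hkp.asymm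
      · exact absurd (hkp.trans (br q hq)) hpq.asymm
    · rcases hq with hq | rfl | hq
      · exact hh.2.2.1.rank_lt hh.1 q hq
      · exact absurd hpq (lt_irrefl _)
      · exact absurd (br q hq) hpq.asymm

theorem subtreeAt_sublist (a : α) (t : ZTree α) : (t.subtreeAt a).nodes.Sublist t.nodes := by
  induction t with
  | leaf => exact List.Sublist.refl _
  | node l k rk r ihl ihr =>
    simp only [subtreeAt]
    split_ifs
    · exact ihl.trans (List.sublist_append_left _ _)
    · exact (ihr.trans (List.sublist_cons_self _ _)).trans (List.sublist_append_right _ _)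
    · exact List.Sublist.refl _

theorem isZipTree.subtreeAt {t : ZTree α} (ht : t.isZipTree) (a : α) :
    (t.subtreeAt a).isZipTree := by
  induction t with
  | leaf => exact ht
  | node l k rk r ihl ihr =>
    simp only [ZTree.subtreeAt]
    split_ifs
    · exact ihl ⟨ht.1.2.2.1, ht.2.2.2.1⟩
    · exact ihr ⟨ht.1.2.2.2, ht.2.2.2.2⟩
    · exact ht

theorem key_eq_of_subtreeAt_eq_node {a k : α} {rk : ℕ} {t l r : ZTree α}
    (h : t.subtreeAt a = node l k rk r) : k = a := by
  induction t with
  | leaf => simp [subtreeAt] at h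
  | node l' k' rk' r' ihl ihr =>
    simp only [subtreeAt] at h
    split_ifs at h with h1 h2
    · exact ihl h
    · exact ihr h
    · injection h with _ h3
      exact h3 ▸ le_antisymm (not_lt.1 h1) (not_lt.1 h2)

theorem isBST.mem_subtreeAt {t : ZTree α} (ht : t.isBST) {a : α} :
    ∀ p ∈ t.nodes, ∀ q₁ ∈ (t.subtreeAt a).nodes, ∀ q₂ ∈ (t.subtreeAt a).nodes,
      q₁.1 ≤ p.1 → p.1 ≤ q₂.1 → p ∈ (t.subtreeAt a).nodes := by
  induction t with
  | leaf => simp [nodes]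
  | node l k rk r ihl ihr =>
    obtain ⟨bl, br, bl', br'⟩ := ht
    intro p hp q₁ hq₁ q₂ hq₂ h₁ h₂
    simp only [subtreeAt] at hq₁ hq₂ ⊢
    split_ifs at hq₁ hq₂ ⊢ with h3 h4
    · have hk := h₂.trans_lt (bl q₂ ((l.subtreeAt_sublist a).subset hq₂))
      simp only [nodes, List.mem_append, List.mem_cons] at hp
      rcases hp with hp | rfl | hp
      · exact ihl bl' p hp q₁ hq₁ q₂ hq₂ h₁ h₂
      · exact absurd hk (lt_irrefl _)
      · exact absurd hk (br p hp).asymm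
    · have hk := (br q₁ ((r.subtreeAt_sublist a).subset hq₁)).trans_le h₁
      simp only [nodes, List.mem_append, List.mem_cons] at hp
      rcases hp with hp | rfl | hp
      · exact absurd hk (bl p hp).asymm
      · exact absurd hk (lt_irrefl _)
      · exact ihr br' p hp q₁ hq₁ q₂ hq₂ h₁ h₂
    · exact hp

/-- In a zip tree with keys `0, …, n - 1` and ranks `f`, the spines zipped when deleting `i` consist
of weak rank records below `f i` to the left of `i`, and of strict rank records up to `f i` to the
right of `i`. -/
theorem isZipTree.zipSpineCount_le {n : ℕ} {f : Fin n → ℕ} {t : ZTree ℕ} (ht : t.isZipTree)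
    (hn : t.nodes.Perm ((List.finRange n).map fun j : Fin n => ((j : ℕ), f j))) (i : Fin n) :
    t.zipSpineCount (i : ℕ) ≤
      ((Finset.Iio i).filter fun j =>
        f j + 1 ≤ f i ∧ ∀ k ∈ Finset.Ioo j i, f k < f j + 1).card +
      ((Finset.Ioi i).filter fun j => f j ≤ f i ∧ ∀ k ∈ Finset.Ioo i j, f k < f j).card := by
  have hmem (p : ℕ × ℕ) : p ∈ t.nodes ↔ ∃ j : Fin n, ((j : ℕ), f j) = p := by
    simp [hn.mem_iff]
  have hnd : t.nodes.Nodup := hn.nodup_iff.2 ((List.nodup_finRange n).map fun a b hab =>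
    Fin.ext (Prod.ext_iff.1 hab).1)
  have hcard (s : List (ℕ × ℕ)) (A : Finset (Fin n)) (hs : s.Sublist t.nodes)
      (hA : ∀ j : Fin n, ((j : ℕ), f j) ∈ s → j ∈ A) : s.length ≤ A.card := by
    classical
    rw [← List.toFinset_card_of_nodup (hnd.sublist hs)]
    refine (Finset.card_le_card fun p hp => ?_).trans
      (Finset.card_image_le (s := A) (f := fun j : Fin n => ((j : ℕ), f j)))
    rw [List.mem_toFinset] at hp
    obtain ⟨j, rfl⟩ := (hmem p).1 (hs.subset hp)
    exact Finset.mem_image_of_mem _ (hA j hp)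
  unfold zipSpineCount
  rcases hS : t.subtreeAt (i : ℕ) with _ | ⟨l, k, rk, r⟩
  · exact Nat.zero_le _
  have hz := ht.subtreeAt (i : ℕ)
  have hsub := t.subtreeAt_sublist (i : ℕ)
  have hconv := ht.1.mem_subtreeAt (a := (i : ℕ))
  rw [hS] at hz hsub hconv
  obtain rfl := key_eq_of_subtreeAt_eq_node hS
  obtain ⟨⟨bl, br, bl', br'⟩, hl, hr, hl', hr'⟩ := hz
  have hroot : ((i : ℕ), rk) ∈ (node l (i : ℕ) rk r).nodes := by simp [nodes]
  have hrk : rk = f i := by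
    obtain ⟨j, hj⟩ := (hmem _).1 (hsub.subset hroot)
    obtain ⟨h1, h2⟩ := Prod.ext_iff.1 hj
    rw [← Fin.ext h1]
    exact h2.symm
  have hlS : l.nodes.Sublist (node l (i : ℕ) rk r).nodes := List.sublist_append_left _ _
  have hrS : r.nodes.Sublist (node l (i : ℕ) rk r).nodes :=
    (List.sublist_cons_self _ _).trans (List.sublist_append_right _ _)
  subst hrk
  refine add_le_add ?_ ?_
  · rw [← length_rightSpine]
    refine hcard _ _ (l.rightSpine_sublist.trans (hlS.trans hsub)) fun j hj => ?_
    have hjl := l.rightSpine_sublist.subset hj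
    simp only [Finset.mem_filter, Finset.mem_Iio, Finset.mem_Ioo]
    refine ⟨bl _ hjl, hl'.rank_lt hl _ hjl, fun m hm => Nat.lt_succ_of_le ?_⟩
    have hmS := hconv _ ((hmem _).2 ⟨m, rfl⟩) _ (hlS.subset hjl) _ hroot
      (Fin.le_def.1 hm.1.le) (Fin.le_def.1 hm.2.le)
    simp only [nodes, List.mem_append, List.mem_cons] at hmS
    rcases hmS with hmS | hmS | hmS
    · exact isZipTree.rank_le_of_mem_rightSpine ⟨bl', hl'⟩ _ hj _ hmS hm.1
    · exact absurd (Fin.ext (Prod.ext_iff.1 hmS).1) hm.2.ne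
    · exact absurd (br _ hmS) (Fin.lt_def.1 hm.2).asymm
  · rw [← length_leftSpine]
    refine hcard _ _ (r.leftSpine_sublist.trans (hrS.trans hsub)) fun j hj => ?_
    have hjr := r.leftSpine_sublist.subset hj
    simp only [Finset.mem_filter, Finset.mem_Ioi, Finset.mem_Ioo]
    refine ⟨br _ hjr, hr'.rank_le hr _ hjr, fun m hm => ?_⟩
    have hmS := hconv _ ((hmem _).2 ⟨m, rfl⟩) _ hroot _ (hrS.subset hjr)
      (Fin.le_def.1 hm.1.le) (Fin.le_def.1 hm.2.le)
    simp only [nodes, List.mem_append, List.mem_cons] at hmS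
    rcases hmS with hmS | hmS | hmS
    · exact absurd (bl _ hmS) (Fin.lt_def.1 hm.1).asymm
    · exact absurd (Fin.ext (Prod.ext_iff.1 hmS).1).symm hm.1.ne
    · exact isZipTree.rank_lt_of_mem_leftSpine ⟨br', hr'⟩ _ hj _ hmS hm.2

end ZTree

theorem ENNReal.tsum_fin_prod {β : Type*} (n : ℕ) (g : Fin n → β → ℝ≥0∞) :
    ∑' f : Fin n → β, ∏ k, g k (f k) = ∏ k, ∑' x, g k x := by
  induction n with
  | zero => simp [tsum_fintype]
  | succ n ih =>
    rw [← (Fin.consEquiv fun _ : Fin (n + 1) => β).tsum_eq, ENNReal.tsum_prod', Fin.prod_univ_succ]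
    simp [Fin.consEquiv, Fin.prod_univ_succ, ENNReal.tsum_mul_left, ENNReal.tsum_mul_right, ih]

theorem tsum_geometric_half : ∑' x : ℕ, (1 / 2 : ℝ≥0∞) ^ (x + 1) = 1 := by
  rw [ENNReal.tsum_geometric_add_one, one_div, ENNReal.one_sub_inv_two, inv_inv,
    ENNReal.inv_mul_cancel two_ne_zero ENNReal.ofNat_ne_top]

theorem tsum_geometric_half_ite_le (t : ℕ) :
    ∑' x : ℕ, (1 / 2 : ℝ≥0∞) ^ (x + 1) * (if t ≤ x then 1 else 0) = (1 / 2) ^ t := by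
  rw [← (add_left_injective t).tsum_eq]
  · simp only [le_add_iff_nonneg_left, zero_le, if_true, mul_one]
    simp_rw [add_right_comm _ t 1, pow_add _ _ t]
    rw [ENNReal.tsum_mul_right, tsum_geometric_half, one_mul]
  · intro x hx
    by_cases h : t ≤ x
    · exact ⟨x - t, Nat.sub_add_cancel h⟩
    · simp [h] at hx

theorem tsum_geometric_half_ite_lt (t : ℕ) :
    ∑' x : ℕ, (1 / 2 : ℝ≥0∞) ^ (x + 1) * (if x < t then 1 else 0) = 1 - (1 / 2) ^ t := by
  refine ENNReal.eq_sub_of_add_eq (by simp) ?_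
  rw [← tsum_geometric_half_ite_le, ← ENNReal.tsum_add]
  refine (tsum_congr fun x => ?_).trans tsum_geometric_half
  rcases lt_or_ge x t with h | h
  · simp [h, h.not_ge]
  · simp [h, h.not_gt]

theorem tsum_mul_geometric_record_le_one (t : ℕ) :
    ∑' d : ℕ, (1 / 2 : ℝ≥0∞) ^ t * (1 - (1 / 2) ^ t) ^ d ≤ 1 := by
  have h : (1 / 2 : ℝ≥0∞) ^ t ≤ 1 := pow_le_one' (by simp) t
  rw [ENNReal.tsum_mul_left, ENNReal.tsum_geometric, ENNReal.sub_sub_cancel ENNReal.one_ne_top h]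
  exact ENNReal.mul_inv_le_one _

/-- For independent geometric ranks `f`, a bound for the probability that `f i` is at least the
threshold `t (f j)` while all the ranks indexed by `S` are below it. -/
theorem tsum_geometric_record_le {n : ℕ} (t : ℕ → ℕ) {i j : Fin n} {S : Finset (Fin n)}
    (hij : j ≠ i) (hi : i ∉ S) (hj : j ∉ S) :
    ∑' f : Fin n → ℕ, (∏ k, (1 / 2 : ℝ≥0∞) ^ (f k + 1)) *
        (if t (f j) ≤ f i ∧ ∀ k ∈ S, f k < t (f j) then 1 else 0) ≤
      ∑' m : ℕ, (1 / 2) ^ (m + 1) * ((1 / 2) ^ t m * (1 - (1 / 2) ^ t m) ^ S.card) := by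
  let g (m : ℕ) (k : Fin n) (x : ℕ) : ℝ≥0∞ := (1 / 2) ^ (x + 1) *
    if (k = j → x = m) ∧ (k = i → t m ≤ x) ∧ (k ∈ S → x < t m) then 1 else 0
  have hg (m : ℕ) (k : Fin n) : ∑' x, g m k x = (if k = j then (1 / 2) ^ (m + 1) else 1) *
      ((if k = i then (1 / 2) ^ t m else 1) * if k ∈ S then 1 - (1 / 2) ^ t m else 1) := by
    by_cases h1 : k = j
    · subst h1
      simp only [g, hij, hj, true_imp_iff, false_imp_iff, and_true, if_true, if_false, mul_one]
      rw [tsum_eq_single m fun x hx => by simp [hx]]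
      simp
    by_cases h2 : k = i
    · subst h2
      simp only [g, h1, hi, true_imp_iff, false_imp_iff, and_true, true_and, if_true, if_false,
        mul_one, one_mul]
      exact tsum_geometric_half_ite_le _
    by_cases h3 : k ∈ S
    · simp only [g, h1, h2, h3, true_imp_iff, false_imp_iff, true_and, if_true, if_false, one_mul]
      exact tsum_geometric_half_ite_lt _
    · simpa only [g, h1, h2, h3, false_imp_iff, and_self, if_true, if_false, mul_one] using
        tsum_geometric_half
  calc _ ≤ ∑' f : Fin n → ℕ, ∑' m, ∏ k, g m k (f k) := by
        refine ENNReal.tsum_le_tsum fun f => ?_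
        split_ifs with h
        · refine le_trans (le_of_eq ?_) (ENNReal.le_tsum (f j))
          rw [mul_one]
          refine Finset.prod_congr rfl fun k _ => ?_
          have hk : (k = j → f k = f j) ∧ (k = i → t (f j) ≤ f k) ∧ (k ∈ S → f k < t (f j)) :=
            ⟨fun e => e ▸ rfl, fun e => e ▸ h.1, h.2 k⟩
          simp only [g, if_pos hk, mul_one]
        · simp
    _ = ∑' m, ∏ k, ∑' x, g m k x := by
        rw [ENNReal.tsum_comm]
        exact tsum_congr fun m => ENNReal.tsum_fin_prod n (g m)
    _ = _ := by
        refine tsum_congr fun m => ?_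
        simp_rw [hg, Finset.prod_mul_distrib, Finset.prod_ite_eq', Finset.prod_ite_mem]
        simp

/-- For independent geometric ranks, the expected number of records seen from `i` is at most one. -/
theorem tsum_geometric_card_records_le_one {n : ℕ} (t : ℕ → ℕ) (i : Fin n) (J : Finset (Fin n))
    (S : Fin n → Finset (Fin n)) (hij : ∀ j ∈ J, j ≠ i) (hi : ∀ j, i ∉ S j) (hj : ∀ j, j ∉ S j)
    (hinj : Set.InjOn (fun j => (S j).card) J) :
    ∑' f : Fin n → ℕ, (∏ k, (1 / 2 : ℝ≥0∞) ^ (f k + 1)) *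
      ((J.filter fun j => t (f j) ≤ f i ∧ ∀ k ∈ S j, f k < t (f j)).card : ℝ≥0∞) ≤ 1 := by
  simp_rw [Finset.card_filter, Nat.cast_sum, Finset.mul_sum, Nat.cast_ite, Nat.cast_one,
    Nat.cast_zero]
  rw [Summable.tsum_finsetSum fun _ _ => ENNReal.summable]
  calc _ ≤ ∑ j ∈ J, ∑' m : ℕ, (1 / 2 : ℝ≥0∞) ^ (m + 1) *
          ((1 / 2) ^ t m * (1 - (1 / 2) ^ t m) ^ (S j).card) :=
        Finset.sum_le_sum fun j h => tsum_geometric_record_le t (hij j h) (hi j) (hj j)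
    _ = ∑' m : ℕ, (1 / 2 : ℝ≥0∞) ^ (m + 1) *
          ∑ d ∈ J.image fun j => (S j).card, (1 / 2) ^ t m * (1 - (1 / 2) ^ t m) ^ d := by
        rw [← Summable.tsum_finsetSum fun _ _ => ENNReal.summable]
        simp_rw [Finset.sum_image hinj, Finset.mul_sum]
    _ ≤ ∑' m : ℕ, (1 / 2 : ℝ≥0∞) ^ (m + 1) * 1 := by
        gcongr with m
        exact (ENNReal.sum_le_tsum _).trans (tsum_mul_geometric_record_le_one _)
    _ = 1 := by simp_rw [mul_one, tsum_geometric_half]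

/-- **Expected restructuring is constant (Theorem 4, expectation part).** Let
`r : Fin n → ℕ` be independent geometric random variables with
`P(r j = m) = 1/2^(m+1)` (modelled by the product PMF `μ`), let `i` be any index, and
let `T r` be the (unique) zip tree on nodes with keys `0, …, n−1` and ranks `r`. Then
the expected total number of nodes on the right spine of the left subtree of node `i`
together with the left spine of the right subtree of node `i` — which is, up to an
additive 1, the number of pointer changes during the unzip performed when inserting
node `i` or the zip performed when deleting it — is at most `2`, hence `O(1)`. -/
theorem expected_zip_path_nodes_const (n : ℕ)
    (μ : PMF (Fin n → ℕ))
    (hμ : ∀ f : Fin n → ℕ, μ f = ∏ j : Fin n, (1 / 2 : ℝ≥0∞) ^ (f j + 1))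
    (T : (Fin n → ℕ) → ZTree ℕ)
    (hT : ∀ f : Fin n → ℕ, (T f).isZipTree ∧
        (T f).nodes.Perm ((List.finRange n).map fun j : Fin n => ((j : ℕ), f j)))
    (i : Fin n) :
    ∑' f : Fin n → ℕ, μ f * (((T f).zipSpineCount (i : ℕ) : ℕ) : ℝ≥0∞) ≤ 2 := by
  have hl := tsum_geometric_card_records_le_one (· + 1) i (Finset.Iio i) (fun j => Finset.Ioo j i)
    (fun j h => (Finset.mem_Iio.1 h).ne) (by simp) (by simp) (fun a ha b hb hab => by
      simp only [Fin.card_Ioo, Finset.coe_Iio, Set.mem_Iio, Fin.lt_def] at ha hb hab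
      omega)
  have hr := tsum_geometric_card_records_le_one (fun m => m) i (Finset.Ioi i)
    (fun j => Finset.Ioo i j)
    (fun j h => (Finset.mem_Ioi.1 h).ne') (by simp) (by simp) (fun a ha b hb hab => by
      simp only [Fin.card_Ioo, Finset.coe_Ioi, Set.mem_Ioi, Fin.lt_def] at ha hb hab
      omega)
  rw [← one_add_one_eq_two]
  refine le_trans ?_ (add_le_add hl hr)
  rw [← ENNReal.tsum_add]
  refine ENNReal.tsum_le_tsum fun f => ?_
  rw [hμ, ← mul_add, ← Nat.cast_add]
  gcongr
  exact (hT f).1.zipSpineCount_le (hT f).2 i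
end
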